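/- Let d ∈ ℕ. There is a constant C > 0 such that for every f ∈ L_1(ℝ^d) and every t > 0, t^d f^{**}(t^d) ≤ C · ω_d(f,t)_1, where ω_d(f,t)_1 is the d-th modulus of smoothness of f in L_1(ℝ^d). -/

import Mathlib

open MeasureTheory ENNReal Set Filter

noncomputable section

abbrev Euc (d : ℕ) := EuclideanSpace ℝ (Fin d)

/-- Non-increasing rearrangement of an `ℝ≥0∞`-valued function w.r.t. a measure. -/
def rearr {α : Type*} [MeasurableSpace α] (μ : Measure α) (g : α → ℝ≥0∞) (t : ℝ) : ℝ≥0∞ :=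
  sInf {l : ℝ≥0∞ | μ {x | l < g x} ≤ ENNReal.ofReal t}

/-- Non-increasing rearrangement of a real-valued function. -/
def rearrR {α : Type*} [MeasurableSpace α] (μ : Measure α) (f : α → ℝ) (t : ℝ) : ℝ≥0∞ :=
  rearr μ (fun x => ENNReal.ofReal |f x|) t

/-- The maximal function `f^{**}(t) = t⁻¹ ∫_0^t f^*`. -/
def rearrStar {α : Type*} [MeasurableSpace α] (μ : Measure α) (f : α → ℝ) (t : ℝ) : ℝ≥0∞ :=
  (ENNReal.ofReal t)⁻¹ * ∫⁻ s in Set.Ioo (0:ℝ) t, rearrR μ f s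

/-- `(∫_I g(t)^q dt/t)^{1/q}`, with the usual sup modification when `q = ∞`. -/
def qnorm (q : ℝ≥0∞) (I : Set ℝ) (g : ℝ → ℝ≥0∞) : ℝ≥0∞ :=
  if q = ∞ then ⨆ t ∈ I, g t
  else (∫⁻ t in I, g t ^ q.toReal / ENNReal.ofReal t) ^ (1 / q.toReal)

/-- `∫_I g(t)^q dt/t` (no outer power), with the sup modification when `q = ∞`. -/
def qint (q : ℝ≥0∞) (I : Set ℝ) (g : ℝ → ℝ≥0∞) : ℝ≥0∞ :=
  if q = ∞ then ⨆ t ∈ I, g t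
  else ∫⁻ t in I, g t ^ q.toReal / ENNReal.ofReal t

/-- Lorentz quasinorm `(∫_I (t^{1/p} f^*(t))^q dt/t)^{1/q}`. -/
def lorentz {α : Type*} [MeasurableSpace α] (μ : Measure α) (f : α → ℝ)
    (p : ℝ) (q : ℝ≥0∞) (I : Set ℝ) : ℝ≥0∞ :=
  qnorm q I (fun t => ENNReal.ofReal (t ^ (1 / p)) * rearrR μ f t)

/-- The cube with lower-left corner `a` and side length `l`. -/
def cubeSet {d : ℕ} (a : Fin d → ℝ) (l : ℝ) : Set (Euc d) :=
  {x | ∀ i, a i ≤ x i ∧ x i ≤ a i + l}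

/-- Cubes in `ℝ^d` with sides parallel to the coordinate axes. -/
def IsCube {d : ℕ} (Q : Set (Euc d)) : Prop := ∃ a l, 0 < l ∧ Q = cubeSet a l

/-- The sharp maximal function `f^{#}` on `ℝ^d`. -/
def sharp {d : ℕ} (f : Euc d → ℝ) (x : Euc d) : ℝ≥0∞ :=
  ⨆ Q ∈ {Q : Set (Euc d) | IsCube Q ∧ x ∈ Q},
    ENNReal.ofReal (⨍ y in Q, |f y - ⨍ z in Q, f z|)

/-- The local sharp maximal function `f^{#}_{Q_0;μ}`. -/
def sharpLocal {d : ℕ} (μ : Measure (Euc d)) (Q0 : Set (Euc d)) (f : Euc d → ℝ)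
    (x : Euc d) : ℝ≥0∞ :=
  ⨆ Q ∈ {Q : Set (Euc d) | IsCube Q ∧ x ∈ Q ∧ Q ⊆ Q0},
    ENNReal.ofReal (⨍ y in Q, |f y - ⨍ z in Q, f z ∂μ| ∂μ)

def diffOp {d : ℕ} (h : Euc d) (f : Euc d → ℝ) : Euc d → ℝ := fun x => f (x + h) - f x

/-- The iterated difference `Δ_h^k f`. -/
def iterDiff {d : ℕ} (k : ℕ) (h : Euc d) (f : Euc d → ℝ) : Euc d → ℝ := (diffOp h)^[k] f

/-- The modulus of smoothness `ω_k(f,t)_{p,q}` on `ℝ^d`. -/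
def modulus {d : ℕ} (k : ℕ) (f : Euc d → ℝ) (p : ℝ) (q : ℝ≥0∞) (t : ℝ) : ℝ≥0∞ :=
  ⨆ h ∈ {h : Euc d | ‖h‖ ≤ t}, lorentz volume (iterDiff k h f) p q (Set.Ioi 0)


/-- The modulus of smoothness `ω_k(f,t)_1` in `L_1(ℝ^d)`. -/
def modulusL1 {d : ℕ} (k : ℕ) (f : Euc d → ℝ) (t : ℝ) : ℝ≥0∞ :=
  ⨆ h ∈ {h : Euc d | ‖h‖ ≤ t}, ∫⁻ x, ENNReal.ofReal |iterDiff k h f x|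


lemma ennreal_layer (a : ℝ≥0∞) :
    a = ∫⁻ l in Ioi (0:ℝ), ({l : ℝ | ENNReal.ofReal l < a}).indicator (fun _ => (1:ℝ≥0∞)) l := by
  have hm : MeasurableSet {l : ℝ | ENNReal.ofReal l < a} :=
    measurableSet_lt ENNReal.measurable_ofReal measurable_const
  rw [lintegral_indicator hm, setLIntegral_one, Measure.restrict_apply hm]
  rcases eq_or_ne a ∞ with rfl | ha
  · simp
  · have : {l : ℝ | ENNReal.ofReal l < a} ∩ Ioi 0 = Ioo 0 a.toReal := by
      ext l
      simp only [mem_inter_iff, mem_ofPred_eq, mem_Ioi, mem_Ioo]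
      constructor
      · rintro ⟨h1, h2⟩
        exact ⟨h2, (ENNReal.ofReal_lt_iff_lt_toReal h2.le ha).1 h1⟩
      · rintro ⟨h1, h2⟩
        exact ⟨(ENNReal.ofReal_lt_iff_lt_toReal h1.le ha).2 h2, h1⟩
    rw [this]
    simp [ha]

lemma rearr_lintegral_le {α : Type*} [MeasurableSpace α] (μ : Measure α) [SFinite μ]
    (g : α → ℝ≥0∞) (hg : Measurable g) (T : ℝ) :
    ∫⁻ s in Ioo (0:ℝ) T, rearr μ g s ≤ ∫⁻ x, g x ∂μ := by
  set D : ℝ → ℝ≥0∞ := fun l => μ {x | ENNReal.ofReal l < g x} with hD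
  have hDanti : Antitone D := by
    intro a b hab
    exact measure_mono fun x hx => lt_of_le_of_lt (ENNReal.ofReal_le_ofReal hab) hx
  have hDm : Measurable D := hDanti.measurable
  calc ∫⁻ s in Ioo (0:ℝ) T, rearr μ g s ≤ ∫⁻ s in Ioi (0:ℝ), rearr μ g s :=
        lintegral_mono_set (fun x hx => hx.1)
    _ ≤ ∫⁻ s in Ioi (0:ℝ), ∫⁻ l in Ioi (0:ℝ),
          ({s : ℝ | ENNReal.ofReal s < D l}).indicator (fun _ => (1:ℝ≥0∞)) s := by
        refine lintegral_mono fun s => ?_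
        rw [ennreal_layer (rearr μ g s)]
        refine lintegral_mono fun l => ?_
        simp only [indicator, mem_ofPred_eq]
        split_ifs with h1 h2
        · exact le_rfl
        · exact absurd h1 (not_lt.2 (sInf_le (not_lt.1 h2)))
        · exact zero_le
        · exact le_rfl
    _ = ∫⁻ l in Ioi (0:ℝ), ∫⁻ s in Ioi (0:ℝ), 
          ({s : ℝ | ENNReal.ofReal s < D l}).indicator (fun _ => (1:ℝ≥0∞)) s := by
        apply lintegral_lintegral_swap
        have : Measurable (({p : ℝ × ℝ | ENNReal.ofReal p.1 < D p.2}).indicator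
            (fun _ => (1:ℝ≥0∞))) := by
          refine measurable_const.indicator (measurableSet_lt ?_ ?_) <;> fun_prop
        exact this.aemeasurable
    _ = ∫⁻ l in Ioi (0:ℝ), D l := by
        refine lintegral_congr fun l => ?_
        exact (ennreal_layer (D l)).symm
    _ = ∫⁻ l in Ioi (0:ℝ), ∫⁻ x, 
          ({l : ℝ | ENNReal.ofReal l < g x}).indicator (fun _ => (1:ℝ≥0∞)) l ∂μ := by
        refine lintegral_congr fun l => ?_
        have hm : MeasurableSet {x | ENNReal.ofReal l < g x} := 
          measurableSet_lt measurable_const hg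
        change μ {x | ENNReal.ofReal l < g x} = _
        rw [← lintegral_indicator_one hm]
        rfl
    _ = ∫⁻ x, (∫⁻ l in Ioi (0:ℝ),
          ({l : ℝ | ENNReal.ofReal l < g x}).indicator (fun _ => (1:ℝ≥0∞)) l) ∂μ := by
        apply lintegral_lintegral_swap
        have : Measurable (({p : ℝ × α | ENNReal.ofReal p.1 < g p.2}).indicator
            (fun _ => (1:ℝ≥0∞))) := by
          refine measurable_const.indicator (measurableSet_lt ?_ ?_) <;> fun_prop
        exact this.aemeasurable
    _ = ∫⁻ x, g x ∂μ := by
        refine lintegral_congr fun x => ?_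
        exact (ennreal_layer (g x)).symm

lemma rearr_le_add {α : Type*} [MeasurableSpace α] (μ : Measure α)
    (g φ : α → ℝ≥0∞) (M : ℝ≥0∞) (h : ∀ x, g x ≤ φ x + M) (s : ℝ) :
    rearr μ g s ≤ rearr μ φ s + M := by
  unfold rearr
  rw [ENNReal.sInf_add]
  refine le_iInf₂ fun l hl => sInf_le ?_
  refine le_trans (measure_mono fun x hx => ?_) hl
  by_contra hc
  exact absurd (lt_of_lt_of_le hx (h x)) (not_lt.2 (by gcongr; exact not_lt.1 hc))

lemma rearr_congr {α : Type*} [MeasurableSpace α] (μ : Measure α)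
    (g φ : α → ℝ≥0∞) (h : g =ᵐ[μ] φ) (s : ℝ) :
    rearr μ g s = rearr μ φ s := by
  unfold rearr
  congr 1
  ext l
  have : μ {x | l < g x} = μ {x | l < φ x} := by
    apply measure_congr
    filter_upwards [h] with x hx
    change (l < g x) = (l < φ x)
    rw [hx]
  simp [this]

lemma one_strip {d : ℕ} (f : Euc d → ℝ) (hf : Measurable f) (hfi : ∫⁻ x, ‖f x‖ₑ ≠ ∞)
    (A B : Set (Euc d)) (hA : MeasurableSet A) (h : Euc d)
    (hdis : Pairwise (Function.onFun Disjoint (fun n : ℕ => {y | y - n • h ∈ A})))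
    (hsub : ∀ n : ℕ, {y | y - n • h ∈ A} ⊆ B) :
    ∫⁻ x in A, ‖f x‖ₑ ≤ ∫⁻ x in B, ‖diffOp h f x‖ₑ := by
  have hAn : ∀ n : ℕ, MeasurableSet {y | y - n • h ∈ A} := fun n =>
    (measurable_id.sub_const _) hA
  have key : ∀ (F : Euc d → ℝ≥0∞) (n : ℕ),
      ∫⁻ x in A, F (x + n • h) = ∫⁻ x in {y | y - n • h ∈ A}, F x := by
    intro F n
    rw [← lintegral_indicator hA, ← lintegral_indicator (hAn n),
      ← lintegral_add_right_eq_self ({y | y - n • h ∈ A}.indicator _) (n • h)]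
    refine lintegral_congr fun x => ?_
    by_cases hx : x ∈ A <;> simp [indicator, hx]
  have hsum : ∀ (F : Euc d → ℝ≥0∞),
      ∑' n : ℕ, ∫⁻ x in A, F (x + n • h) ≤ ∫⁻ x in B, F x := by
    intro F
    simp_rw [key F]
    rw [← lintegral_iUnion hAn hdis]
    exact lintegral_mono_set (iUnion_subset hsub)
  set a : ℕ → ℝ≥0∞ := fun n => ∫⁻ x in A, ‖f (x + n • h)‖ₑ with ha
  set b : ℕ → ℝ≥0∞ := fun n => ∫⁻ x in A, ‖diffOp h f (x + n • h)‖ₑ with hb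
  have hlim : Tendsto a atTop (nhds 0) := by
    apply ENNReal.tendsto_atTop_zero_of_tsum_ne_top
    refine ne_top_of_le_ne_top hfi ?_
    exact (hsum (fun x => ‖f x‖ₑ)).trans (setLIntegral_le_lintegral _ _)
  have hstep : ∀ n, a n ≤ a (n+1) + b n := by
    intro n
    simp only [ha, hb]
    rw [← lintegral_add_left (by fun_prop)]
    refine lintegral_mono fun x => ?_
    have : f (x + n • h) = f (x + (n+1) • h) - diffOp h f (x + n • h) := by
      simp [diffOp, add_smul, add_assoc]
    rw [this]
    exact enorm_sub_le
  have hN : ∀ N, a 0 ≤ a N + ∑ n ∈ Finset.range N, b n := by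
    intro N
    induction N with
    | zero => simp
    | succ N ih =>
      rw [Finset.sum_range_succ]
      calc a 0 ≤ a N + ∑ n ∈ Finset.range N, b n := ih
        _ ≤ (a (N+1) + b N) + ∑ n ∈ Finset.range N, b n := by gcongr; exact hstep N
        _ = _ := by ring
  have hb' : ∀ N, ∑ n ∈ Finset.range N, b n ≤ ∫⁻ x in B, ‖diffOp h f x‖ₑ := fun N =>
    (ENNReal.sum_le_tsum _).trans (hsum (fun x => ‖diffOp h f x‖ₑ))
  have h0 : a 0 = ∫⁻ x in A, ‖f x‖ₑ := by simp [ha]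
  rw [← h0]
  have : Tendsto (fun N => a N + ∫⁻ x in B, ‖diffOp h f x‖ₑ) atTop
      (nhds (0 + ∫⁻ x in B, ‖diffOp h f x‖ₑ)) := hlim.add tendsto_const_nhds
  rw [zero_add] at this
  exact ge_of_tendsto' this fun N => (hN N).trans (by gcongr; exact hb' N)

def mixedD {d : ℕ} (h : ℕ → Euc d) (f : Euc d → ℝ) : ℕ → Euc d → ℝ
  | 0 => f
  | n+1 => diffOp (h n) (mixedD h f n)

lemma mixedD_sum {d : ℕ} (h : ℕ → Euc d) (f : Euc d → ℝ) (n : ℕ) (x : Euc d) :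
    mixedD h f n x = (-1)^n * ∑ S ∈ (Finset.range n).powerset,
      (-1)^(S.card) * f (x + ∑ j ∈ S, h j) := by
  induction n generalizing x with
  | zero => simp [mixedD]
  | succ n ih =>
    rw [Finset.range_add_one, Finset.sum_powerset_insert (by simp)]
    simp only [mixedD, diffOp, ih]
    have : ∑ t ∈ (Finset.range n).powerset, (-1:ℝ)^((insert n t).card) *
        f (x + ∑ j ∈ insert n t, h j) = - ∑ t ∈ (Finset.range n).powerset, (-1:ℝ)^(t.card) *
        f (x + h n + ∑ j ∈ t, h j) := by
      rw [← Finset.sum_neg_distrib]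
      refine Finset.sum_congr rfl fun t ht => ?_
      have hn : n ∉ t := fun hh => by simpa using Finset.mem_powerset.1 ht hh
      rw [Finset.card_insert_of_notMem hn, Finset.sum_insert hn, add_assoc]
      ring
    rw [this]
    ring

lemma mixedD_zero {d : ℕ} (h : ℕ → Euc d) (f : Euc d → ℝ) (n k : ℕ) (hk : k < n) (h0 : h k = 0)
    (x : Euc d) : mixedD h f n x = 0 := by
  induction n generalizing x with
  | zero => omega
  | succ n ih =>
    simp only [mixedD, diffOp]
    rcases Nat.lt_succ_iff_lt_or_eq.1 hk with h1 | h1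
    · simp [ih h1]
    · subst h1; simp [h0]

lemma iterDiff_sum {d : ℕ} (n : ℕ) (h : Euc d) (f : Euc d → ℝ) (x : Euc d) :
    iterDiff n h f x = ∑ k ∈ Finset.range (n+1),
      ((-1:ℝ)^(n-k) * n.choose k) * f (x + (k:ℝ) • h) := by
  have := fwdDiff_iter_eq_sum_shift h f n x
  have h2 : iterDiff n h f x = (fwdDiff h)^[n] f x := rfl
  rw [h2, this]
  refine Finset.sum_congr rfl fun k _ => ?_
  simp [zsmul_eq_mul, Nat.cast_smul_eq_nsmul]

lemma kemperman {d : ℕ} (n : ℕ) (h : ℕ → Euc d) (f : Euc d → ℝ) (x : Euc d) :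
    mixedD h f n x = ∑ S ∈ (Finset.range n).powerset, (-1)^(S.card) *
      iterDiff n (∑ j ∈ S, (-(1/((j:ℝ)+1))) • h j) f (x + ∑ j ∈ S, h j) := by
  simp_rw [iterDiff_sum, Finset.mul_sum]
  rw [Finset.sum_comm, Finset.sum_range_succ']
  have hz : ∀ k ∈ Finset.range n, ∑ S ∈ (Finset.range n).powerset, (-1:ℝ)^(S.card) *
      ((-1:ℝ)^(n-(k+1)) * n.choose (k+1) * f (x + ∑ j ∈ S, h j +
        ((k+1 : ℕ):ℝ) • ∑ j ∈ S, (-(1/((j:ℝ)+1))) • h j)) = 0 := by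
    intro k hk
    have h1 := mixedD_zero (fun j => h j + ((k+1 : ℕ):ℝ) • (-(1/((j:ℝ)+1))) • h j) f n k
      (by simpa using hk) (by
        have : ((k:ℝ)+1) ≠ 0 := by positivity
        rw [smul_smul]
        push_cast
        rw [mul_neg, mul_one_div_cancel this]; simp) x
    rw [mixedD_sum] at h1
    have h2 := (mul_eq_zero.1 h1).resolve_left (by simp)
    calc _ = ((-1:ℝ)^(n-(k+1)) * n.choose (k+1)) * ∑ S ∈ (Finset.range n).powerset,
        (-1:ℝ)^(S.card) * f (x + ∑ j ∈ S, (h j + ((k+1 : ℕ):ℝ) • (-(1/((j:ℝ)+1))) • h j)) := by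
          rw [Finset.mul_sum]
          refine Finset.sum_congr rfl fun S _ => ?_
          rw [Finset.sum_add_distrib, Finset.smul_sum, add_assoc]
          ring
      _ = 0 := by rw [h2, mul_zero]
  rw [Finset.sum_eq_zero hz, mixedD_sum, Finset.mul_sum, zero_add]
  refine Finset.sum_congr rfl fun S _ => ?_
  simp
  ring

def stepv (d : ℕ) (s : ℝ) (j : ℕ) : Euc d :=
  WithLp.toLp 2 (fun i : Fin d => if (i:ℕ) = j then s else 0)

def strip (d : ℕ) (s : ℝ) (j : ℕ) : Set (Euc d) :=
  {y | ∀ i : Fin d, j ≤ (i:ℕ) → 0 ≤ y i ∧ y i < s}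

lemma strip_meas (d : ℕ) (s : ℝ) (j : ℕ) : MeasurableSet (strip d s j) := by
  have : strip d s j = ⋂ i : Fin d, ⋂ (_ : j ≤ (i:ℕ)), {y : Euc d | 0 ≤ y i ∧ y i < s} := by
    ext y; simp [strip]
  rw [this]
  refine MeasurableSet.iInter fun i => MeasurableSet.iInter fun _ => ?_
  have hi : Measurable fun y : Euc d => y i := by fun_prop
  exact (measurableSet_le measurable_const hi).inter (measurableSet_lt hi measurable_const)

lemma strip_vol (d : ℕ) (s : ℝ) : volume (strip d s 0) = ENNReal.ofReal s ^ d := by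
  have h1 : strip d s 0 = (@WithLp.ofLp 2 (Fin d → ℝ)) ⁻¹'
      (Set.univ.pi fun _ : Fin d => Ico (0:ℝ) s) := by
    ext y; simp [strip]
  rw [h1, (PiLp.volume_preserving_ofLp (Fin d)).measure_preimage
    (MeasurableSet.univ_pi fun _ => measurableSet_Ico).nullMeasurableSet, volume_pi_pi]
  simp

lemma strip_norm (d : ℕ) (s : ℝ) (u : Euc d) (hu : u ∈ strip d s 0) : ‖u‖ ≤ d * s := by
  have h1 : ∀ i, ‖u i‖ ≤ s := fun i => by
    have := hu i (Nat.zero_le _)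
    rw [Real.norm_of_nonneg this.1]; exact this.2.le
  have h2 : u = ∑ i, EuclideanSpace.single i (u i) := by
    ext j
    simp [Finset.sum_apply]
  rw [h2]
  refine (norm_sum_le _ _).trans ?_
  refine (Finset.sum_le_sum (g := fun _ => s) fun i _ => ?_).trans ?_
  · simpa using h1 i
  · simp

lemma stepv_norm (d : ℕ) (s : ℝ) (hs : 0 ≤ s) (j : ℕ) : ‖stepv d s j‖ ≤ s := by
  by_cases hj : j < d
  · have : stepv d s j = EuclideanSpace.single (⟨j, hj⟩ : Fin d) s := by
      ext i
      simp [stepv, Fin.ext_iff]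
    rw [this]
    simp [abs_of_nonneg hs]
  · have : stepv d s j = 0 := by
      ext i
      have : (i:ℕ) ≠ j := by omega
      simp [stepv, this]
    rw [this]
    simpa using hs

lemma diffOp_meas {d : ℕ} (h : Euc d) (f : Euc d → ℝ) (hf : Measurable f) :
    Measurable (diffOp h f) := by
  unfold diffOp; fun_prop

lemma diffOp_fin {d : ℕ} (h : Euc d) (f : Euc d → ℝ) (hf : Measurable f)
    (hfi : ∫⁻ x, ‖f x‖ₑ ≠ ∞) : ∫⁻ x, ‖diffOp h f x‖ₑ ≠ ∞ := by
  have : ∫⁻ x, ‖diffOp h f x‖ₑ ≤ (∫⁻ x, ‖f (x + h)‖ₑ) + ∫⁻ x, ‖f x‖ₑ := by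
    rw [← lintegral_add_left (by fun_prop)]
    exact lintegral_mono fun x => enorm_sub_le
  rw [lintegral_add_right_eq_self (fun x => ‖f x‖ₑ) h] at this
  exact ne_top_of_le_ne_top (by simp [hfi]) this

lemma mixedD_meas {d : ℕ} (h : ℕ → Euc d) (f : Euc d → ℝ) (hf : Measurable f) (n : ℕ) :
    Measurable (mixedD h f n) := by
  induction n with
  | zero => exact hf
  | succ n ih => exact diffOp_meas _ _ ih

lemma mixedD_fin {d : ℕ} (h : ℕ → Euc d) (f : Euc d → ℝ) (hf : Measurable f)
    (hfi : ∫⁻ x, ‖f x‖ₑ ≠ ∞) (n : ℕ) : ∫⁻ x, ‖mixedD h f n x‖ₑ ≠ ∞ := by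
  induction n with
  | zero => exact hfi
  | succ n ih => exact diffOp_fin _ _ (mixedD_meas h f hf n) ih

lemma box_bound {d : ℕ} (s : ℝ) (hs : 0 < s) (f : Euc d → ℝ) (hf : Measurable f)
    (hfi : ∫⁻ x, ‖f x‖ₑ ≠ ∞) :
    ∫⁻ x in strip d s 0, ‖f x‖ₑ ≤ ∫⁻ x, ‖mixedD (stepv d s) f d x‖ₑ := by
  have : ∀ j ≤ d, ∫⁻ x in strip d s 0, ‖f x‖ₑ ≤
      ∫⁻ x in strip d s j, ‖mixedD (stepv d s) f j x‖ₑ := by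
    intro j
    induction j with
    | zero => intro _; exact le_rfl
    | succ j ih =>
      intro hj
      refine (ih (by omega)).trans ?_
      refine one_strip _ (mixedD_meas _ f hf j) (mixedD_fin _ f hf hfi j) _ _
        (strip_meas d s j) (stepv d s j) ?_ ?_
      · have main : ∀ n : ℕ, ∀ y : Euc d, y - n • stepv d s j ∈ strip d s j →
            (n:ℝ) * s ≤ y ⟨j, hj⟩ ∧ y ⟨j, hj⟩ < ((n:ℝ)+1) * s := by
          intro n y hy
          have := hy ⟨j, hj⟩ le_rfl
          simp [stepv] at this
          constructor <;> linarith
        intro m n hmn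
        refine Set.disjoint_left.2 fun y hy1 hy2 => hmn ?_
        have h1 := main m y hy1
        have h2 := main n y hy2
        have h3 : (m:ℝ) < n + 1 := lt_of_mul_lt_mul_right (h1.1.trans_lt h2.2) hs.le
        have h4 : (n:ℝ) < m + 1 := lt_of_mul_lt_mul_right (h2.1.trans_lt h1.2) hs.le
        norm_cast at h3 h4
        omega
      · intro n y hy i hi
        have := hy i (by omega)
        have hij : (i:ℕ) ≠ j := by omega
        simpa [stepv, hij] using this
  refine (this d le_rfl).trans (setLIntegral_le_lintegral _ _)

lemma scale_le {d : ℕ} (c : ℝ) (hc : 1 ≤ c) (x : Euc d) (F : Euc d → ℝ≥0∞) (hF : Measurable F) :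
    ∫⁻ u, F (x + c • u) ≤ ∫⁻ u, F u := by
  have h0 : c ≠ 0 := by positivity
  have h1 : ∫⁻ u : Euc d, F (x + c • u) = ∫⁻ v, F (x + v) ∂(Measure.map (fun u : Euc d => c • u) volume) := by
    rw [lintegral_map (by fun_prop) (by fun_prop)]
  rw [h1, Measure.map_addHaar_smul _ h0, lintegral_smul_measure, lintegral_add_left_eq_self F x]
  have : ENNReal.ofReal |(c ^ Module.finrank ℝ (Euc d))⁻¹| ≤ 1 := by
    rw [ENNReal.ofReal_le_one, abs_of_nonneg (by positivity)]
    exact inv_le_one_of_one_le₀ (one_le_pow₀ hc)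
  calc _ ≤ 1 * ∫⁻ u, F u := by rw [smul_eq_mul]; gcongr
    _ = _ := one_mul _

lemma iterDiff_meas {d : ℕ} (n : ℕ) (h : Euc d) (f : Euc d → ℝ) (hf : Measurable f) :
    Measurable (iterDiff n h f) := by
  have : iterDiff n h f = fun x => ∑ k ∈ Finset.range (n+1),
      ((-1:ℝ)^(n-k) * n.choose k) * f (x + (k:ℝ) • h) := by
    ext x; exact iterDiff_sum n h f x
  rw [this]; fun_prop

lemma le_modulus {d : ℕ} (n : ℕ) (h : Euc d) (f : Euc d → ℝ) (t : ℝ) (ht : ‖h‖ ≤ t) :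
    ∫⁻ x, ‖iterDiff n h f x‖ₑ ≤ modulusL1 n f t := by
  simp_rw [Real.enorm_eq_ofReal_abs]
  exact le_iSup₂ (f := fun (h : Euc d) (_ : h ∈ {h : Euc d | ‖h‖ ≤ t}) =>
    ∫⁻ x, ENNReal.ofReal |iterDiff n h f x|) h ht

lemma avg_bound {d : ℕ} (s t : ℝ) (hs : 0 < s) (hst : d * (d * s) ≤ t)
    (f : Euc d → ℝ) (hf : Measurable f)
    (hfi : ∫⁻ x, ‖f x‖ₑ ≠ ∞) (k : ℕ) (hk : 1 ≤ k) (hkd : k ≤ d) (x : Euc d) :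
    ∫⁻ u in strip d s 0, ‖f (x + (k:ℝ) • u)‖ₑ ≤ 2^d * modulusL1 d f t := by
  have hk' : (1:ℝ) ≤ k := by exact_mod_cast hk
  set F : Euc d → ℝ := fun u => f (x + (k:ℝ) • u) with hFdef
  have hF : Measurable F := by fun_prop
  have hFi : ∫⁻ u, ‖F u‖ₑ ≠ ∞ :=
    ne_top_of_le_ne_top hfi (scale_le (k:ℝ) hk' x (fun y => ‖f y‖ₑ) (by fun_prop))
  have hit : ∀ v u, iterDiff d v F u = iterDiff d ((k:ℝ) • v) f (x + (k:ℝ) • u) := by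
    intro v u
    rw [iterDiff_sum, iterDiff_sum]
    refine Finset.sum_congr rfl fun l _ => ?_
    simp only [hFdef]
    rw [smul_add, add_assoc, smul_comm]
  refine (box_bound s hs F hF hFi).trans ?_
  have hterm : ∀ S ∈ (Finset.range d).powerset, ∫⁻ u, ‖(-1:ℝ)^(S.card) *
      iterDiff d (∑ j ∈ S, (-(1/((j:ℝ)+1))) • stepv d s j) F (u + ∑ j ∈ S, stepv d s j)‖ₑ
      ≤ modulusL1 d f t := by
    intro S hS
    set v := ∑ j ∈ S, (-(1/((j:ℝ)+1))) • stepv d s j with hv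
    have hcard : S.card ≤ d := by simpa using Finset.card_le_card (Finset.mem_powerset.1 hS)
    have hvn : ‖v‖ ≤ d * s := by
      refine (norm_sum_le _ _).trans ?_
      refine (Finset.sum_le_sum (g := fun _ => s) fun j _ => ?_).trans ?_
      · rw [norm_smul, norm_neg, Real.norm_of_nonneg (by positivity)]
        have h1 : 1/((j:ℝ)+1) ≤ 1 := by
          rw [div_le_one (by positivity)]
          have : (0:ℝ) ≤ j := by positivity
          linarith
        calc _ ≤ 1 * s := mul_le_mul h1 (stepv_norm d s hs.le j) (norm_nonneg _) zero_le_one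
          _ = s := one_mul s
      · simp only [Finset.sum_const, nsmul_eq_mul]
        gcongr
    have hkv : ‖(k:ℝ) • v‖ ≤ t := by
      rw [norm_smul, Real.norm_of_nonneg (by positivity)]
      refine le_trans ?_ hst
      gcongr
    calc ∫⁻ u, ‖(-1:ℝ)^(S.card) * iterDiff d v F (u + ∑ j ∈ S, stepv d s j)‖ₑ
        = ∫⁻ u, ‖iterDiff d v F (u + ∑ j ∈ S, stepv d s j)‖ₑ := by
          refine lintegral_congr fun u => ?_
          simp [enorm_mul, enorm_pow]
      _ = ∫⁻ u, ‖iterDiff d v F u‖ₑ :=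
          lintegral_add_right_eq_self (fun u => ‖iterDiff d v F u‖ₑ) _
      _ = ∫⁻ u, ‖iterDiff d ((k:ℝ) • v) f (x + (k:ℝ) • u)‖ₑ := by simp_rw [hit]
      _ ≤ ∫⁻ u, ‖iterDiff d ((k:ℝ) • v) f u‖ₑ :=
          scale_le (k:ℝ) hk' x (fun y => ‖iterDiff d ((k:ℝ) • v) f y‖ₑ)
            (iterDiff_meas _ _ f hf).enorm
      _ ≤ _ := le_modulus _ _ _ _ hkv
  calc ∫⁻ u, ‖mixedD (stepv d s) F d u‖ₑ
      ≤ ∫⁻ u, ∑ S ∈ (Finset.range d).powerset, ‖(-1:ℝ)^(S.card) *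
      iterDiff d (∑ j ∈ S, (-(1/((j:ℝ)+1))) • stepv d s j) F (u + ∑ j ∈ S, stepv d s j)‖ₑ := by
        refine lintegral_mono fun u => ?_
        rw [kemperman]
        exact enorm_sum_le _ _
    _ = ∑ S ∈ (Finset.range d).powerset, ∫⁻ u, ‖(-1:ℝ)^(S.card) *
      iterDiff d (∑ j ∈ S, (-(1/((j:ℝ)+1))) • stepv d s j) F (u + ∑ j ∈ S, stepv d s j)‖ₑ := by
        refine lintegral_finsetSum _ fun S _ => ?_
        have := iterDiff_meas d (∑ j ∈ S, (-(1/((j:ℝ)+1))) • stepv d s j) F hF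
        fun_prop
    _ ≤ ∑ S ∈ (Finset.range d).powerset, modulusL1 d f t := Finset.sum_le_sum hterm
    _ = _ := by simp

lemma pointwise {d : ℕ} (s t : ℝ) (hs : 0 < s) (hst : d * (d * s) ≤ t)
    (f : Euc d → ℝ) (hf : Measurable f)
    (hfi : ∫⁻ x, ‖f x‖ₑ ≠ ∞) (x : Euc d) :
    ENNReal.ofReal s ^ d * ‖f x‖ₑ ≤ (∫⁻ u in strip d s 0, ‖iterDiff d u f x‖ₑ) +
      4^d * modulusL1 d f t := by
  have hpt : ∀ u : Euc d, ‖f x‖ₑ ≤ ‖iterDiff d u f x‖ₑ +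
      ∑ k ∈ Finset.range d, (d.choose (k+1) : ℝ≥0∞) * ‖f (x + ((k+1:ℕ):ℝ) • u)‖ₑ := by
    intro u
    have h1 := iterDiff_sum d u f x
    rw [Finset.sum_range_succ'] at h1
    have h2 : (-1:ℝ)^d * f x = iterDiff d u f x - ∑ k ∈ Finset.range d,
        ((-1:ℝ)^(d-(k+1)) * d.choose (k+1)) * f (x + ((k+1:ℕ):ℝ) • u) := by
      rw [h1]; simp
    have h3 : ‖f x‖ₑ = ‖(-1:ℝ)^d * f x‖ₑ := by simp [enorm_mul, enorm_pow]
    rw [h3, h2]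
    refine enorm_sub_le.trans ?_
    gcongr
    refine (enorm_sum_le _ _).trans (le_of_eq ?_)
    refine Finset.sum_congr rfl fun k _ => ?_
    simp [enorm_mul, enorm_pow]
  have hm : ∀ k : ℕ, Measurable fun u : Euc d => ‖f (x + ((k+1:ℕ):ℝ) • u)‖ₑ := by
    intro k; fun_prop
  calc ENNReal.ofReal s ^ d * ‖f x‖ₑ = ∫⁻ u in strip d s 0, ‖f x‖ₑ := by
        rw [setLIntegral_const, strip_vol, mul_comm]
    _ ≤ ∫⁻ u in strip d s 0, (‖iterDiff d u f x‖ₑ +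
      ∑ k ∈ Finset.range d, (d.choose (k+1) : ℝ≥0∞) * ‖f (x + ((k+1:ℕ):ℝ) • u)‖ₑ) :=
        lintegral_mono hpt
    _ = (∫⁻ u in strip d s 0, ‖iterDiff d u f x‖ₑ) + ∑ k ∈ Finset.range d,
        (d.choose (k+1) : ℝ≥0∞) * ∫⁻ u in strip d s 0, ‖f (x + ((k+1:ℕ):ℝ) • u)‖ₑ := by
        rw [lintegral_add_right _ (by fun_prop), lintegral_finsetSum _ (by fun_prop)]
        congr 1
        refine Finset.sum_congr rfl fun k _ => ?_
        rw [lintegral_const_mul _ (hm k)]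
    _ ≤ (∫⁻ u in strip d s 0, ‖iterDiff d u f x‖ₑ) + ∑ k ∈ Finset.range d,
        (d.choose (k+1) : ℝ≥0∞) * (2^d * modulusL1 d f t) := by
        gcongr with k hk
        exact avg_bound s t hs hst f hf hfi (k+1) (by omega)
          (by have := Finset.mem_range.1 hk; omega) x
    _ ≤ _ := by
        gcongr
        rw [← Finset.sum_mul, ← mul_assoc]
        gcongr
        have h4 : (4:ℝ≥0∞)^d = 2^d * 2^d := by rw [← mul_pow]; norm_num
        rw [h4]
        gcongr
        have h5 : ∑ k ∈ Finset.range d, d.choose (k+1) ≤ 2^d := by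
          rw [← Nat.sum_range_choose d, Finset.sum_range_succ']
          omega
        exact_mod_cast h5

lemma main_meas {d : ℕ} (hd : 0 < d) (f : Euc d → ℝ) (hf : Measurable f)
    (hfi : ∫⁻ x, ‖f x‖ₑ ≠ ∞) (t : ℝ) (ht : 0 < t) :
    ∫⁻ r in Ioo (0:ℝ) (t^d), rearr volume (fun x => ‖f x‖ₑ) r ≤
      ENNReal.ofReal (1 + (4 * d * d)^d) * modulusL1 d f t := by
  have hd' : (1:ℝ) ≤ d := by exact_mod_cast hd
  set s : ℝ := t / (d * d) with hsdef
  have hs : 0 < s := by positivity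
  have hst : d * (d * s) ≤ t := by rw [hsdef]; apply le_of_eq; field_simp
  have hV0 : ENNReal.ofReal s ^ d ≠ 0 := by simp [hs]
  have hVt : ENNReal.ofReal s ^ d ≠ ∞ := by simp
  set V := ENNReal.ofReal s ^ d with hV
  set ω := modulusL1 d f t with hω
  have hjm : Measurable (fun p : Euc d × Euc d => ‖iterDiff d p.2 f p.1‖ₑ) := by
    simp_rw [iterDiff_sum]
    fun_prop
  set ψ : Euc d → ℝ≥0∞ := fun x => V⁻¹ * ∫⁻ u in strip d s 0, ‖iterDiff d u f x‖ₑ with hψ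
  have hψm : Measurable ψ := (Measurable.lintegral_prod_right hjm).const_mul _
  have hψi : ∫⁻ x, ψ x ≤ ω := by
    rw [hψ, lintegral_const_mul _ (Measurable.lintegral_prod_right hjm),
      lintegral_lintegral_swap hjm.aemeasurable]
    calc V⁻¹ * ∫⁻ u in strip d s 0, ∫⁻ x, ‖iterDiff d u f x‖ₑ
        ≤ V⁻¹ * ∫⁻ u in strip d s 0, ω := by
          refine mul_le_mul_right ?_ _
          refine setLIntegral_mono measurable_const fun u hu => le_modulus _ _ _ _ ?_
          refine (strip_norm d s u hu).trans (le_trans ?_ hst)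
          have : 0 ≤ d * s := by positivity
          nlinarith
      _ = ω := by
          rw [setLIntegral_const, strip_vol, mul_comm ω, ← mul_assoc,
            ENNReal.inv_mul_cancel hV0 hVt, one_mul]
  have hpt : ∀ x, ‖f x‖ₑ ≤ ψ x + V⁻¹ * (4^d * ω) := by
    intro x
    have := pointwise s t hs hst f hf hfi x
    rw [hψ, ← mul_add]
    calc ‖f x‖ₑ = V⁻¹ * (V * ‖f x‖ₑ) := by
          rw [← mul_assoc, ENNReal.inv_mul_cancel hV0 hVt, one_mul]
      _ ≤ _ := by gcongr
  calc ∫⁻ r in Ioo (0:ℝ) (t^d), rearr volume (fun x => ‖f x‖ₑ) r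
      ≤ ∫⁻ r in Ioo (0:ℝ) (t^d), (rearr volume ψ r + V⁻¹ * (4^d * ω)) :=
        lintegral_mono fun r => rearr_le_add _ _ _ _ hpt r
    _ = (∫⁻ r in Ioo (0:ℝ) (t^d), rearr volume ψ r) + V⁻¹ * (4^d * ω) * ENNReal.ofReal (t^d) := by
        rw [lintegral_add_right _ measurable_const, setLIntegral_const, Real.volume_Ioo, sub_zero]
    _ ≤ ω + V⁻¹ * (4^d * ω) * ENNReal.ofReal (t^d) := by
        gcongr
        exact (rearr_lintegral_le _ ψ hψm _).trans hψi
    _ = _ := by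
        have h1 : ENNReal.ofReal (t^d) = V * ENNReal.ofReal ((d*d:ℝ)^d) := by
          rw [hV, ← ENNReal.ofReal_pow hs.le, ← ENNReal.ofReal_mul (by positivity), ← mul_pow]
          congr 2
          rw [hsdef]; field_simp
        have h2 : ENNReal.ofReal (1 + (4 * d * d)^d) = 1 + 4^d * ENNReal.ofReal ((d*d:ℝ)^d) := by
          rw [ENNReal.ofReal_add (by norm_num) (by positivity), ENNReal.ofReal_one, mul_assoc,
            mul_pow, ENNReal.ofReal_mul (by positivity), ENNReal.ofReal_pow (by norm_num)]
          norm_num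
        rw [h1, h2]
        calc _ = ω + (V⁻¹ * V) * (4^d * ENNReal.ofReal ((d*d:ℝ)^d) * ω) := by ring
          _ = _ := by rw [ENNReal.inv_mul_cancel hV0 hVt]; ring

lemma modulus_congr {d : ℕ} (n : ℕ) (f g : Euc d → ℝ) (h : f =ᵐ[volume] g) (t : ℝ) :
    modulusL1 n f t = modulusL1 n g t := by
  unfold modulusL1
  refine iSup_congr fun v => iSup_congr fun _ => lintegral_congr_ae ?_
  have h1 : ∀ k : ℕ, ∀ᵐ x : Euc d, f (x + (k:ℝ) • v) = g (x + (k:ℝ) • v) := fun k =>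
    (measurePreserving_add_right volume ((k:ℝ) • v)).quasiMeasurePreserving.ae h
  filter_upwards [ae_all_iff.2 h1] with x hx
  rw [iterDiff_sum, iterDiff_sum]
  simp_rw [hx]

/-- `t^d f^{**}(t^d) ≲ ω_d(f,t)_1` for `f ∈ L_1(ℝ^d)` (Theorem 1.1, (1.9)). -/
theorem statement2 (d : ℕ) (hd : 0 < d) :
    ∃ C : ℝ, 0 < C ∧ ∀ f : Euc d → ℝ, Integrable f volume →
      ∀ t : ℝ, 0 < t →
        ENNReal.ofReal (t ^ d) * rearrStar volume f (t ^ d) ≤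
          ENNReal.ofReal C * modulusL1 d f t := by
  refine ⟨1 + (4 * d * d)^d, by positivity, fun f hfint t ht => ?_⟩
  obtain ⟨g, hg, hfg⟩ := hfint.aestronglyMeasurable
  have hgi : ∫⁻ x, ‖g x‖ₑ ≠ ∞ := ((hfint.congr hfg).hasFiniteIntegral).ne
  have hT : ENNReal.ofReal (t^d) ≠ 0 := by simp; positivity
  rw [rearrStar, ← mul_assoc, ENNReal.mul_inv_cancel hT ENNReal.ofReal_ne_top, one_mul,
    modulus_congr d f g hfg t]
  refine le_trans (le_of_eq ?_) (main_meas hd g hg.measurable hgi t ht)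
  refine lintegral_congr fun r => ?_
  refine rearr_congr _ _ _ ?_ r
  filter_upwards [hfg] with x hx
  rw [hx, Real.enorm_eq_ofReal_abs]

end
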